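/- arXiv:2112.13525 — 2 statements merged into one kernel-verified Lean document; each statement's English description precedes it below -/
import Mathlib

section
/- Every Vir_B-module endomorphism of V^φ_{α,β,ψ} = V(φ) ⊗ V'_{α,β,ψ} is a scalar multiple of the identity; that is, End_{Vir_B}(V^φ_{α,β,ψ}) ≅ ℂ. In particular V^φ_{α,β,ψ} is indecomposable. -/
open Finsupp TensorProduct

noncomputable section

/-- Loop-Virasoro carrier: `Vir ⊗ B ≅ (⊕_{n∈ℤ} d_n ⊗ B) ⊕ (C ⊗ B)`. -/
abbrev LVir (B : Type*) [AddCommMonoid B] : Type _ := (ℤ →₀ B) × B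

variable (B : Type*) [CommRing B] [Algebra ℂ B]

/-- `[d_m ⊗ a, d_n ⊗ b] = (n-m) d_{m+n} ⊗ ab + δ_{m,-n} ((m³-m)/12) C ⊗ ab`. -/
def ldBracket (m n : ℤ) (a b : B) : LVir B :=
  (Finsupp.single (m + n) ((((n : ℂ) - (m : ℂ))) • (a * b)),
    (if m = -n then ((m : ℂ) ^ 3 - (m : ℂ)) / 12 else 0) • (a * b))

/-- The bracket of the loop-Virasoro algebra `Vir_B = Vir ⊗ B`; `C ⊗ B` is central. -/
def lvirBracket (x y : LVir B) : LVir B :=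
  x.1.sum fun m a => y.1.sum fun n b => ldBracket B m n a b

/-- Action of `d_n` on `V_{α,β}` -/
def dAct (α β : ℂ) (n : ℤ) : Module.End ℂ (ℤ →₀ ℂ) :=
  Finsupp.lsum ℂ fun k => (α + (k : ℂ) + (n : ℂ) * β) • Finsupp.lsingle (k + n)

/-- Action of `Vir_B` on `V_{α,β,ψ}`:  `(d_n ⊗ b) · v_k = ψ(b)(α + k + nβ) v_{k+n}`,
`(C ⊗ b) · v_k = 0`. -/
def lAction (α β : ℂ) (ψ : B →ₐ[ℂ] ℂ) : LVir B →ₗ[ℂ] Module.End ℂ (ℤ →₀ ℂ) :=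
  (Finsupp.lsum ℂ fun n =>
      (LinearMap.toSpanSingleton ℂ (Module.End ℂ (ℤ →₀ ℂ)) (dAct α β n)).comp ψ.toLinearMap).comp
    (LinearMap.fst ℂ (ℤ →₀ B) B)

def ActInvariant {L V : Type*} [AddCommGroup V] [Module ℂ V]
    (act : L → Module.End ℂ V) (U : Submodule ℂ V) : Prop :=
  ∀ x : L, ∀ v ∈ U, act x v ∈ U

def ActIrreducible {L V : Type*} [AddCommGroup V] [Module ℂ V]
    (act : L → Module.End ℂ V) : Prop :=
  ∀ U : Submodule ℂ V, ActInvariant act U → U = ⊥ ∨ U = ⊤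

def ActGenerates {L V : Type*} [AddCommGroup V] [Module ℂ V]
    (act : L → Module.End ℂ V) (S : Set V) : Prop :=
  ∀ U : Submodule ℂ V, ActInvariant act U → S ⊆ U → U = ⊤

/-- Data of the irreducible highest weight `Vir_B`-module `V(φ)` attached to a one-dimensional
representation `φ` of `Vir⁰_B` (given by its values `φd b = φ(d_0 ⊗ b)`, `φC b = φ(C ⊗ b)`),
with highest weight vector `hv = v_φ`. -/
structure HWRep (B : Type*) [CommRing B] [Algebra ℂ B]
    (W : Type*) [AddCommGroup W] [Module ℂ W] where
  ρ : LVir B →ₗ[ℂ] Module.End ℂ W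
  rep : ∀ x y : LVir B, ρ (lvirBracket B x y) = ρ x * ρ y - ρ y * ρ x
  hv : W
  hv_ne : hv ≠ 0
  φd : B →ₗ[ℂ] ℂ
  φC : B →ₗ[ℂ] ℂ
  hw : ∀ n : ℤ, 0 < n → ∀ b : B, ρ (Finsupp.single n b, 0) hv = 0
  wt0 : ∀ b : B, ρ (Finsupp.single 0 b, 0) hv = φd b • hv
  cen : ∀ b : B, ρ (0, b) hv = φC b • hv
  gen : ActGenerates (fun x => ρ x) {hv}
  irr : ActIrreducible (fun x => ρ x)

/-- The tensor product module `V^φ_{α,β,ψ} = V(φ) ⊗ V'_{α,β,ψ}`. -/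
def tensAct {W : Type*} [AddCommGroup W] [Module ℂ W] (D : HWRep B W)
    (α β : ℂ) (ψ : B →ₐ[ℂ] ℂ) (x : LVir B) : Module.End ℂ (W ⊗[ℂ] (ℤ →₀ ℂ)) :=
  TensorProduct.map (D.ρ x) LinearMap.id + TensorProduct.map LinearMap.id (lAction B α β ψ x)

variable {B}

lemma lvirBracket_single_single (m n : ℤ) (a b : B) :
    lvirBracket B (Finsupp.single m a, 0) (Finsupp.single n b, 0) = ldBracket B m n a b := by
  unfold lvirBracket
  rw [Finsupp.sum_single_index (by simp [ldBracket]),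
    Finsupp.sum_single_index (by simp [ldBracket])]

lemma dAct_single (α β : ℂ) (n k : ℤ) (c : ℂ) :
    dAct α β n (Finsupp.single k c) = Finsupp.single (k + n) ((α + k + n * β) * c) := by
  simp [dAct]

lemma lAction_single (α β : ℂ) (ψ : B →ₐ[ℂ] ℂ) (n : ℤ) (b c : B) :
    lAction B α β ψ (Finsupp.single n b, c) = ψ b • dAct α β n := by
  simp [lAction]

/-- Irreducibility of `V_{α,0,ψ}` forces `α ∉ ℤ`. -/
lemma add_intCast_ne_zero_of_actIrreducible (α : ℂ) (ψ : B →ₐ[ℂ] ℂ)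
    (hirr : ActIrreducible (fun x : LVir B => lAction B α 0 ψ x)) (k : ℤ) : α + k ≠ 0 := by
  intro h
  have hinv : ActInvariant (fun x : LVir B => lAction B α 0 ψ x)
      (Submodule.span ℂ {Finsupp.single k (1 : ℂ)}) := by
    intro x v hv
    obtain ⟨c, rfl⟩ := Submodule.mem_span_singleton.1 hv
    have h0 : lAction B α 0 ψ x (c • Finsupp.single k (1 : ℂ)) = 0 := by
      simp [lAction, Finsupp.sum, LinearMap.sum_apply, dAct_single, h]
    simp only [h0, Submodule.zero_mem]
  rcases hirr _ hinv with h1 | h1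
  · simp at h1
  · have : Finsupp.single (k + 1) (1 : ℂ) ∈ Submodule.span ℂ {Finsupp.single k (1 : ℂ)} := by
      rw [h1]; trivial
    obtain ⟨c, hc⟩ := Submodule.mem_span_singleton.1 this
    simpa using congrArg (fun f => f (k + 1)) hc

namespace HWRep

variable {W : Type*} [AddCommGroup W] [Module ℂ W] (D : HWRep B W)

lemma commute_apply (x y : LVir B) (w : W) :
    D.ρ x (D.ρ y w) = D.ρ y (D.ρ x w) + D.ρ (lvirBracket B x y) w := by
  rw [D.rep]; simp

lemma commute_single_apply {m n : ℤ} (h : m ≠ -n) (a b : B) (w : W) :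
    D.ρ (Finsupp.single m a, 0) (D.ρ (Finsupp.single n b, 0) w) =
      D.ρ (Finsupp.single n b, 0) (D.ρ (Finsupp.single m a, 0) w) +
      D.ρ (Finsupp.single (m + n) (((n : ℂ) - m) • (a * b)), 0) w := by
  rw [D.commute_apply, lvirBracket_single_single, ldBracket, if_neg h, zero_smul]

/-- `V(φ)` is generated by its highest weight vector under the negative part of `Vir_B`. -/
theorem eq_top_of_negative_invariant (U : Submodule ℂ W) (hU : D.hv ∈ U)
    (hneg : ∀ m : ℤ, m < 0 → ∀ a : B, ∀ w ∈ U, D.ρ (Finsupp.single m a, 0) w ∈ U) :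
    U = ⊤ := by
  let M : Submodule ℂ W := sInf {U | D.hv ∈ U ∧
    ∀ m : ℤ, m < 0 → ∀ a : B, ∀ w ∈ U, D.ρ (Finsupp.single m a, 0) w ∈ U}
  have hM : ∀ U' : Submodule ℂ W, D.hv ∈ U' →
      (∀ m : ℤ, m < 0 → ∀ a : B, ∀ w ∈ U', D.ρ (Finsupp.single m a, 0) w ∈ U') → M ≤ U' :=
    fun U' h1 h2 => sInf_le ⟨h1, h2⟩
  have hvM : D.hv ∈ M := Submodule.mem_sInf.2 fun U h => h.1
  have hMneg : ∀ m : ℤ, m < 0 → ∀ a : B, ∀ w ∈ M, D.ρ (Finsupp.single m a, 0) w ∈ M :=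
    fun m hm a w hw => Submodule.mem_sInf.2 fun U h =>
      h.2 m hm a w (Submodule.mem_sInf.1 hw U h)
  let M' : Submodule ℂ W := M ⊓ ⨅ x : LVir B, M.comap (D.ρ x)
  have hmem : ∀ w, w ∈ M' ↔ w ∈ M ∧ ∀ x, D.ρ x w ∈ M := fun w => by
    simp [M', Submodule.mem_iInf]
  have hMM' : M ≤ M' := by
    refine hM M' ((hmem _).2 ⟨hvM, fun x => ?_⟩) fun m hm a w hw => ?_
    · obtain ⟨f, b⟩ := x
      have hx : ((f, b) : LVir B) = LinearMap.inl ℂ (ℤ →₀ B) B f + (0, b) := by simp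
      rw [hx, map_add, LinearMap.add_apply, D.cen]
      refine M.add_mem ?_ (M.smul_mem _ hvM)
      induction f using Finsupp.induction_linear with
      | zero => rw [map_zero, map_zero]; exact M.zero_mem
      | add f g hf hg =>
        rw [map_add, map_add, LinearMap.add_apply]
        exact M.add_mem (hf (by simp)) (hg (by simp))
      | single n a =>
        rw [LinearMap.inl_apply]
        rcases lt_trichotomy n 0 with hn | rfl | hn
        · exact hMneg n hn a _ hvM
        · rw [D.wt0]; exact M.smul_mem _ hvM
        · rw [D.hw n hn]; exact M.zero_mem
    · rw [hmem] at hw ⊢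
      refine ⟨hMneg m hm a w hw.1, fun x => ?_⟩
      rw [D.commute_apply]
      exact M.add_mem (hMneg m hm a _ (hw.2 x)) (hw.2 _)
  have hMtop : M = ⊤ := D.gen M (fun x w hw => ((hmem w).1 (hMM' hw)).2 x) (by simpa using hvM)
  exact top_le_iff.1 (hMtop ▸ hM U hU hneg)

/-- Every vector of `V(φ)` is annihilated by `d_n ⊗ b` for all large `n`, uniformly in `b`. -/
theorem exists_annihilated (w : W) :
    ∃ N : ℕ, ∀ n : ℤ, N < n → ∀ b : B, D.ρ (Finsupp.single n b, 0) w = 0 := by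
  let S : Submodule ℂ W :=
    { carrier := {w | ∃ N : ℕ, ∀ n : ℤ, N < n → ∀ b : B, D.ρ (Finsupp.single n b, 0) w = 0}
      zero_mem' := ⟨0, by simp⟩
      add_mem' := by
        rintro u v ⟨N, hN⟩ ⟨N', hN'⟩
        refine ⟨N + N', fun n hn b => ?_⟩
        rw [map_add, hN n (by omega), hN' n (by omega), add_zero]
      smul_mem' := by
        rintro c u ⟨N, hN⟩
        exact ⟨N, fun n hn b => by rw [map_smul, hN n hn, smul_zero]⟩ }
  have hS : S = ⊤ := by
    refine D.eq_top_of_negative_invariant S ⟨0, fun n hn b => D.hw n (by simpa using hn) b⟩ ?_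
    rintro m hm a w ⟨N, hN⟩
    refine ⟨N + m.natAbs, fun n hn b => ?_⟩
    rw [D.commute_single_apply (by omega), hN n (by omega), hN (n + m) (by omega)]
    simp
  have : w ∈ S := hS ▸ Submodule.mem_top
  exact this

theorem exists_annihilated_finsupp (f : ℤ →₀ W) :
    ∃ N : ℕ, ∀ n : ℤ, N < n → ∀ (b : B) (i : ℤ), D.ρ (Finsupp.single n b, 0) (f i) = 0 := by
  choose N hN using D.exists_annihilated
  refine ⟨f.support.sup fun i => N (f i), fun n hn b i => ?_⟩
  by_cases hi : i ∈ f.support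
  · refine hN _ n (lt_of_le_of_lt ?_ hn) b
    exact_mod_cast Finset.le_sup (f := fun i => N (f i)) hi
  · rw [Finsupp.notMem_support_iff.1 hi, map_zero]

/-- The highest weight space of `V(φ)` is spanned by the highest weight vector. -/
theorem eq_smul_hv_of_weight (w : W)
    (hw : D.ρ (Finsupp.single 0 1, 0) w = D.φd 1 • w) : ∃ c : ℂ, w = c • D.hv := by
  set d₀ : Module.End ℂ W := D.ρ (Finsupp.single 0 1, 0) with hd₀
  let L : Submodule ℂ W := ⨆ μ ≠ D.φd 1, d₀.eigenspace μ
  let K : Submodule ℂ W := ⨆ j : ℕ, d₀.eigenspace (D.φd 1 - (j + 1))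
  have hKL : K ≤ L := by
    refine iSup_le fun j => le_iSup₂_of_le (D.φd 1 - (j + 1)) ?_ le_rfl
    intro h
    have : (j : ℂ) + 1 = 0 := by linear_combination -h
    exact Nat.cast_add_one_ne_zero j this
  have hshift : ∀ (m : ℕ) (a : B) (μ : ℂ) (u : W), d₀ u = μ • u →
      d₀ (D.ρ (Finsupp.single (-(m + 1 : ℤ)) a, 0) u) =
        (μ - (m + 1)) • D.ρ (Finsupp.single (-(m + 1 : ℤ)) a, 0) u := by
    intro m a μ u hu
    rw [hd₀, D.commute_single_apply (by omega), ← hd₀, hu]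
    have : ((Finsupp.single (0 + -(m + 1 : ℤ))
        ((((-(m + 1 : ℤ) : ℤ) : ℂ) - ((0 : ℤ) : ℂ)) • ((1 : B) * a)), 0) : LVir B) =
        (-((m : ℂ) + 1)) • (Finsupp.single (-(m + 1 : ℤ)) a, 0) := by
      simp
    rw [this, map_smul, map_smul, LinearMap.smul_apply]
    module
  have htop : Submodule.span ℂ {D.hv} ⊔ K = ⊤ := by
    refine D.eq_top_of_negative_invariant _
      (Submodule.mem_sup_left (Submodule.mem_span_singleton_self _)) ?_
    intro m hm a
    obtain ⟨p, rfl⟩ : ∃ p : ℕ, m = -(p + 1 : ℤ) := ⟨(-m - 1).toNat, by omega⟩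
    suffices h : Submodule.span ℂ {D.hv} ⊔ K ≤
        K.comap (D.ρ (Finsupp.single (-(p + 1 : ℤ)) a, 0)) from
      fun w hw => Submodule.mem_sup_right (h hw)
    refine sup_le ?_ (iSup_le fun j u hu => ?_)
    · rw [Submodule.span_singleton_le_iff_mem, Submodule.mem_comap]
      refine Submodule.mem_iSup_of_mem p ?_
      rw [Module.End.mem_eigenspace_iff]
      exact hshift p a _ _ (D.wt0 1)
    · rw [Submodule.mem_comap]
      refine Submodule.mem_iSup_of_mem (j + p + 1) ?_
      rw [Module.End.mem_eigenspace_iff] at hu ⊢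
      rw [hshift p a _ _ hu]
      congr 1
      push_cast
      ring
  have hwtop : w ∈ Submodule.span ℂ {D.hv} ⊔ K := htop ▸ Submodule.mem_top
  obtain ⟨y, hy, z, hz, rfl⟩ := Submodule.mem_sup.1 hwtop
  obtain ⟨c, rfl⟩ := Submodule.mem_span_singleton.1 hy
  have hz' : z ∈ d₀.eigenspace (D.φd 1) := by
    rw [Module.End.mem_eigenspace_iff]
    rw [map_add, map_smul, D.wt0] at hw
    rw [← add_right_inj (c • D.φd 1 • D.hv), hw]
    module
  have hdisj : Disjoint (d₀.eigenspace (D.φd 1)) L := d₀.eigenspaces_iSupIndep (D.φd 1)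
  have hz0 : z = 0 := Submodule.disjoint_def.1 hdisj z hz' (hKL hz)
  exact ⟨c, by rw [hz0, add_zero]⟩

end HWRep

section Tensor

variable {W : Type*} [AddCommGroup W] [Module ℂ W] (D : HWRep B W)
  (α β : ℂ) (ψ : B →ₐ[ℂ] ℂ)

lemma tensAct_tmul (x : LVir B) (w : W) (v : ℤ →₀ ℂ) :
    tensAct B D α β ψ x (w ⊗ₜ v) = D.ρ x w ⊗ₜ v + w ⊗ₜ lAction B α β ψ x v := by
  simp [tensAct]

lemma tensAct_single_tmul_single (n k : ℤ) (b : B) (w : W) :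
    tensAct B D α β ψ (Finsupp.single n b, 0) (w ⊗ₜ Finsupp.single k 1) =
      D.ρ (Finsupp.single n b, 0) w ⊗ₜ Finsupp.single k 1 +
        (ψ b * (α + k + n * β)) • w ⊗ₜ Finsupp.single (k + n) 1 := by
  rw [tensAct_tmul, lAction_single, LinearMap.smul_apply, dAct_single, ← TensorProduct.tmul_smul,
    Finsupp.smul_single, Finsupp.smul_single, smul_eq_mul, smul_eq_mul, mul_one, mul_one]

/-- The coefficients of an element of `W ⊗ V` with respect to the basis `v_i` of `V`. -/
def tensCoeff (W : Type*) [AddCommGroup W] [Module ℂ W] :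
    W ⊗[ℂ] (ℤ →₀ ℂ) ≃ₗ[ℂ] (ℤ →₀ W) :=
  TensorProduct.finsuppScalarRight ℂ ℂ W ℤ

lemma tensCoeff_tmul_single (w : W) (k : ℤ) (c : ℂ) :
    tensCoeff W (w ⊗ₜ Finsupp.single k c) = Finsupp.single k (c • w) := by
  ext i
  simp [tensCoeff, TensorProduct.finsuppScalarRight_apply_tmul]

lemma tensor_induction {p : W ⊗[ℂ] (ℤ →₀ ℂ) → Prop} (zero : p 0)
    (add : ∀ s t, p s → p t → p (s + t))
    (single : ∀ w k, p (w ⊗ₜ Finsupp.single k 1)) (t : W ⊗[ℂ] (ℤ →₀ ℂ)) : p t := by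
  induction t using TensorProduct.induction_on with
  | zero => exact zero
  | add s t hs ht => exact add s t hs ht
  | tmul w v =>
    induction v using Finsupp.induction_linear with
    | zero => simpa using zero
    | add u v hu hv => rw [TensorProduct.tmul_add]; exact add _ _ hu hv
    | single k c =>
      have : w ⊗ₜ[ℂ] Finsupp.single k c = (c • w) ⊗ₜ[ℂ] Finsupp.single k (1 : ℂ) := by
        rw [TensorProduct.smul_tmul]; simp
      rw [this]
      exact single _ _

lemma tensCoeff_tensAct (n : ℤ) (b : B) (t : W ⊗[ℂ] (ℤ →₀ ℂ)) (i : ℤ) :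
    tensCoeff W (tensAct B D α β ψ (Finsupp.single n b, 0) t) (i + n) =
      D.ρ (Finsupp.single n b, 0) (tensCoeff W t (i + n)) +
        (ψ b * (α + i + n * β)) • tensCoeff W t i := by
  induction t using tensor_induction with
  | zero => simp
  | add s t hs ht =>
    simp only [map_add, Finsupp.add_apply, smul_add, hs, ht]
    abel
  | single w k =>
    rw [tensAct_single_tmul_single]
    simp only [map_add, map_smul, tensCoeff_tmul_single, one_smul, Finsupp.add_apply,
      Finsupp.smul_apply]
    congr 1
    · by_cases h : k = i + n
      · simp [h]
      · simp [Finsupp.single_eq_of_ne' h]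
    · by_cases h : k = i
      · simp [h]
      · have h' : k + n ≠ i + n := by omega
        simp [Finsupp.single_eq_of_ne' h, Finsupp.single_eq_of_ne' h']

/-- The structure constants of `d_n d_m` and `d_{m+n}` on `v_k` and `v_{k+j}` with `a = α + k`
are not proportional for suitable large `m, n`. -/
lemma exists_structure_constants_ne (a β j : ℂ) (hj : j ≠ 0)
    (h : β = 0 → a ≠ 0 ∧ a + j ≠ 0) (N : ℕ) :
    ∃ m n : ℤ, N < m ∧ N < n ∧
      (a + j + m * β) * (a + j + m + n * β) * (a + (m + n) * β) ≠
        (a + m * β) * (a + m + n * β) * (a + j + (m + n) * β) := by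
  by_contra! hcon
  have h0 := hcon (N + 1) (N + 1) (by omega) (by omega)
  have h1 := hcon (N + 2) (N + 1) (by omega) (by omega)
  have h2 := hcon (N + 3) (N + 1) (by omega) (by omega)
  push_cast at h0 h1 h2
  by_cases hβ : β = 0
  · obtain ⟨ha, haj⟩ := h hβ
    subst hβ
    have : a * (a + j) * j = 0 := by linear_combination h0
    simp_all
  · have : j * β ^ 2 = 0 := by linear_combination (h0 - 2 * h1 + h2) / 2
    simp_all

variable {D α β ψ} {T : W ⊗[ℂ] (ℤ →₀ ℂ) →ₗ[ℂ] W ⊗[ℂ] (ℤ →₀ ℂ)}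

/-- An endomorphism multiplies each `v_φ ⊗ v_k` by a scalar. -/
theorem endomorphism_hv_tmul_single
    (hT : ∀ (x : LVir B) (v : W ⊗[ℂ] (ℤ →₀ ℂ)),
      T (tensAct B D α β ψ x v) = tensAct B D α β ψ x (T v))
    (hα : β = 0 → ∀ k : ℤ, α + k ≠ 0) (k : ℤ) :
    ∃ c : ℂ, T (D.hv ⊗ₜ Finsupp.single k 1) = c • D.hv ⊗ₜ Finsupp.single k 1 := by
  set t := T (D.hv ⊗ₜ Finsupp.single k 1) with ht
  obtain ⟨N, hN⟩ := D.exists_annihilated_finsupp (tensCoeff W t)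
  have hpos : ∀ (n l : ℤ), 0 < n →
      tensAct B D α β ψ (Finsupp.single n 1, 0) (D.hv ⊗ₜ Finsupp.single l 1) =
        (α + l + n * β) • D.hv ⊗ₜ Finsupp.single (l + n) 1 := by
    intro n l hn
    rw [tensAct_single_tmul_single, D.hw n hn]
    simp
  have hone : ∀ n i : ℤ, N < n →
      tensCoeff W (tensAct B D α β ψ (Finsupp.single n 1, 0) t) (i + n) =
        (α + i + n * β) • tensCoeff W t i := by
    intro n i hn
    rw [tensCoeff_tensAct, hN n hn]
    simp
  have hann : ∀ m n i : ℤ, N < m → N < n → D.ρ (Finsupp.single n 1, 0)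
      (tensCoeff W (tensAct B D α β ψ (Finsupp.single m 1, 0) t) i) = 0 := by
    intro m n i hm hn
    obtain ⟨i, rfl⟩ : ∃ i', i = i' + m := ⟨i - m, by ring⟩
    rw [hone m i hm, map_smul, hN n hn, smul_zero]
  have hsupp : ∀ i, i ≠ k → tensCoeff W t i = 0 := by
    intro i hi
    obtain ⟨m, n, hm, hn, hne⟩ := exists_structure_constants_ne (α + k) β ((i - k : ℤ) : ℂ)
      (by exact_mod_cast sub_ne_zero.2 hi)
      (fun hβ => ⟨hα hβ k, by
        have := hα hβ i
        push_cast
        simpa using this⟩) N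
    have h1 : T (tensAct B D α β ψ (Finsupp.single (m + n) 1, 0) (D.hv ⊗ₜ Finsupp.single k 1)) =
        (α + k + (m + n) * β) • T (D.hv ⊗ₜ Finsupp.single (k + m + n) 1) := by
      rw [hpos _ _ (by omega), map_smul, ← add_assoc]
      push_cast
      rfl
    have h2 : T (tensAct B D α β ψ (Finsupp.single n 1, 0)
        (tensAct B D α β ψ (Finsupp.single m 1, 0) (D.hv ⊗ₜ Finsupp.single k 1))) =
        ((α + k + m * β) * (α + k + m + n * β)) • T (D.hv ⊗ₜ Finsupp.single (k + m + n) 1) := by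
      rw [hpos _ _ (by omega), map_smul, hpos _ _ (by omega), map_smul, map_smul, smul_smul]
      push_cast
      congr 2
      ring
    rw [hT, ← ht] at h1
    rw [hT, hT, ← ht] at h2
    have h1' := congrArg (fun s => tensCoeff W s (i + (m + n))) h1
    have h2' := congrArg (fun s => tensCoeff W s (i + m + n)) h2
    simp only [map_smul, Finsupp.smul_apply] at h1' h2'
    rw [hone _ _ (by omega), ← add_assoc] at h1'
    rw [tensCoeff_tensAct, hann m n _ hm hn, hone m i hm, zero_add, smul_smul] at h2'
    set z := tensCoeff W (T (D.hv ⊗ₜ Finsupp.single (k + m + n) 1)) (i + m + n)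
    have h3 : ((α + k + (i - k : ℤ) + m * β) * (α + k + (i - k : ℤ) + m + n * β) *
          (α + k + (m + n) * β) -
        (α + k + m * β) * (α + k + m + n * β) * (α + k + (i - k : ℤ) + (m + n) * β)) •
          tensCoeff W t i = 0 := by
      push_cast at h1' h2' ⊢
      rw [map_one] at h2'
      linear_combination (norm := module) (α + k + (m + n) * β) • h2' -
        ((α + k + m * β) * (α + k + m + n * β)) • h1'
    exact (smul_eq_zero.1 h3).resolve_left (sub_ne_zero.2 hne)
  set w := tensCoeff W t k with hw
  have htw : t = w ⊗ₜ Finsupp.single k 1 := by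
    apply (tensCoeff W).injective
    rw [tensCoeff_tmul_single, one_smul]
    ext i
    by_cases h : i = k
    · simp [h, hw]
    · rw [hsupp i h, Finsupp.single_eq_of_ne h]
  have hwt : D.ρ (Finsupp.single 0 1, 0) w = D.φd 1 • w := by
    have h := hT (Finsupp.single 0 1, 0) (D.hv ⊗ₜ Finsupp.single k 1)
    rw [tensAct_single_tmul_single, D.wt0, map_add, ← TensorProduct.smul_tmul', map_smul,
      map_smul, add_zero, ← ht, htw, tensAct_single_tmul_single, add_zero, add_left_inj] at h
    have h' := congrArg (fun s => tensCoeff W s k) h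
    simpa [tensCoeff_tmul_single] using h'.symm
  obtain ⟨c, hc⟩ := D.eq_smul_hv_of_weight w hwt
  exact ⟨c, by rw [htw, hc, TensorProduct.smul_tmul']⟩

theorem endomorphism_eq_smul_id
    (hT : ∀ (x : LVir B) (v : W ⊗[ℂ] (ℤ →₀ ℂ)),
      T (tensAct B D α β ψ x v) = tensAct B D α β ψ x (T v))
    (hα : β = 0 → ∀ k : ℤ, α + k ≠ 0) :
    ∃ c : ℂ, T = c • LinearMap.id := by
  choose c hc using endomorphism_hv_tmul_single hT hα
  have hne : ∀ k : ℤ, D.hv ⊗ₜ[ℂ] Finsupp.single k (1 : ℂ) ≠ 0 := by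
    intro k h
    have := congrArg (fun s => tensCoeff W s k) h
    simp [tensCoeff_tmul_single, D.hv_ne] at this
  have hstep : ∀ k n : ℤ, 0 < n → α + k + n * β ≠ 0 → c (k + n) = c k := by
    intro k n hn h
    have h1 := hT (Finsupp.single n 1, 0) (D.hv ⊗ₜ Finsupp.single k 1)
    rw [hc, map_smul, tensAct_single_tmul_single, D.hw n hn, TensorProduct.zero_tmul, zero_add,
      map_smul, hc, map_one, one_mul, smul_comm (c k)] at h1
    exact smul_left_injective ℂ (hne _) (smul_right_injective _ h h1)
  have hlarge : ∀ k : ℤ, ∃ N : ℤ, ∀ n, N < n → c n = c k := by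
    intro k
    by_cases hz : ∃ n : ℤ, α + k + n * β = 0
    · obtain ⟨n₀, hn₀⟩ := hz
      refine ⟨k + max n₀ 0, fun n hn => ?_⟩
      have h := hstep k (n - k) (by omega) fun h0 => ?_
      · rwa [add_sub_cancel] at h
      · have hm : ((n - k - n₀ : ℤ) : ℂ) * β = 0 := by
          push_cast at h0 ⊢
          linear_combination h0 - hn₀
        rcases mul_eq_zero.1 hm with h1 | h1
        · have : n - k - n₀ = 0 := by exact_mod_cast h1
          omega
        · subst h1
          exact hα rfl k (by simpa using hn₀)
    · push Not at hz
      refine ⟨k, fun n hn => ?_⟩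
      have h := hstep k (n - k) (by omega) (hz _)
      rwa [add_sub_cancel] at h
  have hconst : ∀ k, c k = c 0 := by
    intro k
    obtain ⟨N, hN⟩ := hlarge k
    obtain ⟨N', hN'⟩ := hlarge 0
    rw [← hN (max N N' + 1) (by omega), hN' _ (by omega)]
  refine ⟨c 0, ?_⟩
  let U : Submodule ℂ W :=
    ⨅ v : ℤ →₀ ℂ, LinearMap.ker ((T - c 0 • LinearMap.id) ∘ₗ (TensorProduct.mk ℂ W _).flip v)
  have hmem : ∀ w, w ∈ U ↔ ∀ v, T (w ⊗ₜ v) = c 0 • w ⊗ₜ v := by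
    intro w
    simp [U, Submodule.mem_iInf, sub_eq_zero]
  have hU : U = ⊤ := by
    refine D.gen U (fun x w hw => ?_) ?_
    · rw [hmem] at hw ⊢
      intro v
      have h := hT x (w ⊗ₜ v)
      rw [hw, map_smul, tensAct_tmul, map_add, hw, smul_add, add_left_inj] at h
      exact h
    · rw [Set.singleton_subset_iff, SetLike.mem_coe, hmem]
      intro v
      induction v using Finsupp.induction_linear with
      | zero => simp
      | add u v hu hv => rw [TensorProduct.tmul_add, map_add, hu, hv, smul_add]
      | single k a =>
        rw [← mul_one a, ← smul_eq_mul, ← Finsupp.smul_single, TensorProduct.tmul_smul, map_smul,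
          hc, hconst, smul_comm]
  refine TensorProduct.ext' fun w v => ?_
  exact (hmem w).1 (hU ▸ Submodule.mem_top) v

end Tensor

variable (B)

/-- Every `Vir_B`-module endomorphism of `V^φ_{α,β,ψ} = V(φ) ⊗ V'_{α,β,ψ}` is a scalar
multiple of the identity, i.e. `End_{Vir_B}(V^φ_{α,β,ψ}) ≅ ℂ`; in particular
`V^φ_{α,β,ψ}` is indecomposable. -/
theorem tensor_endomorphisms_trivial {W : Type*} [AddCommGroup W] [Module ℂ W]
    (D : HWRep B W) (α β : ℂ) (hα0 : 0 ≤ α.re) (hα1 : α.re < 1) (hβ : β ≠ 1)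
    (ψ : B →ₐ[ℂ] ℂ) (hirr : ActIrreducible (fun x : LVir B => lAction B α β ψ x)) :
    (∀ T : W ⊗[ℂ] (ℤ →₀ ℂ) →ₗ[ℂ] W ⊗[ℂ] (ℤ →₀ ℂ),
      (∀ (x : LVir B) (v : W ⊗[ℂ] (ℤ →₀ ℂ)),
        T (tensAct B D α β ψ x v) = tensAct B D α β ψ x (T v)) →
      ∃ c : ℂ, T = c • (LinearMap.id : W ⊗[ℂ] (ℤ →₀ ℂ) →ₗ[ℂ] W ⊗[ℂ] (ℤ →₀ ℂ))) ∧
    (∀ U U' : Submodule ℂ (W ⊗[ℂ] (ℤ →₀ ℂ)),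
      ActInvariant (V := W ⊗[ℂ] (ℤ →₀ ℂ)) (tensAct B D α β ψ) U →
      ActInvariant (V := W ⊗[ℂ] (ℤ →₀ ℂ)) (tensAct B D α β ψ) U' →
      IsCompl U U' → U = ⊥ ∨ U = ⊤) := by
  have hα : β = 0 → ∀ k : ℤ, α + k ≠ 0 := by
    rintro rfl
    exact add_intCast_ne_zero_of_actIrreducible α ψ hirr
  refine ⟨fun T hT => endomorphism_eq_smul_id hT hα, fun U U' hU hU' hc => ?_⟩
  have hP : ∀ (x : LVir B) (v : W ⊗[ℂ] (ℤ →₀ ℂ)),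
      U.projection U' hc (tensAct B D α β ψ x v) = tensAct B D α β ψ x (U.projection U' hc v) := by
    intro x v
    obtain ⟨u, hu, u', hu', rfl⟩ :=
      Submodule.mem_sup.1 (hc.sup_eq_top ▸ Submodule.mem_top : v ∈ U ⊔ U')
    simp only [map_add, Submodule.projection_apply_of_mem_left hc hu,
      (Submodule.projection_apply_eq_zero_iff hc).2 hu',
      Submodule.projection_apply_of_mem_left hc (hU x u hu),
      (Submodule.projection_apply_eq_zero_iff hc).2 (hU' x u' hu'), map_zero]
  obtain ⟨c, h⟩ := endomorphism_eq_smul_id hP hα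
  by_cases h0 : c = 0
  · left
    rw [eq_bot_iff]
    intro u hu
    have := Submodule.projection_apply_of_mem_left hc hu
    rw [h, h0] at this
    simpa using this.symm
  · right
    have hbot : U' = ⊥ := by
      rw [eq_bot_iff]
      intro u hu
      have := (Submodule.projection_apply_eq_zero_iff hc).2 hu
      rw [h] at this
      simpa [h0] using this
    simpa [hbot] using hc.sup_eq_top
end
end

section
/- Suppose α ± β ∉ ℤ and b ∈ B with ψ(b) ≠ 0. If φ vanishes on d_0 ⊗ ⟨b⟩ (where ⟨b⟩ is the ideal of B generated by b), then the Vir_B-module V^φ_{α,β,ψ} = V(φ) ⊗ V'_{α,β,ψ} is irreducible. -/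
open Finsupp TensorProduct

noncomputable section

variable (B : Type*) [CommRing B] [Algebra ℂ B]

section HighestWeight

variable {B} {W : Type*} [AddCommGroup W] [Module ℂ W] (D : HWRep B W)

namespace HWRep

/-- The operator by which `d_n ⊗ a` acts on the highest weight module. -/
def d (n : ℤ) (a : B) : Module.End ℂ W := D.ρ (Finsupp.single n a, 0)

/-- The operator by which `C ⊗ a` acts on the highest weight module. -/
def c (a : B) : Module.End ℂ W := D.ρ (0, a)

lemma c_comm (a : B) (x : LVir B) (w : W) : D.c a (D.ρ x w) = D.ρ x (D.c a w) := by
  have h := congrArg (fun f => f w) (D.rep (0, a) x)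
  simp only [lvirBracket, Finsupp.sum_zero_index, map_zero, LinearMap.zero_apply,
    LinearMap.sub_apply, Module.End.mul_apply] at h
  exact sub_eq_zero.mp h.symm

lemma d_comm (m n : ℤ) (a a' : B) (w : W) :
    D.d m a (D.d n a' w) = D.d n a' (D.d m a w) + ((n : ℂ) - m) • D.d (m + n) (a * a') w +
      (if m = -n then ((m : ℂ) ^ 3 - m) / 12 else 0) • D.c (a * a') w := by
  have h := congrArg (fun f => f w) (D.rep (Finsupp.single m a, 0) (Finsupp.single n a', 0))
  have hb : lvirBracket B (Finsupp.single m a, 0) (Finsupp.single n a', 0) =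
      ((n : ℂ) - m) • ((Finsupp.single (m + n) (a * a'), 0) : LVir B) +
        (if m = -n then ((m : ℂ) ^ 3 - m) / 12 else 0) • ((0, a * a') : LVir B) := by
    rw [lvirBracket, Finsupp.sum_single_index, Finsupp.sum_single_index, ldBracket,
      Prod.smul_mk, Prod.smul_mk, Prod.mk_add_mk, Finsupp.smul_single, smul_zero, smul_zero,
      add_zero, zero_add]
    · simp [ldBracket]
    · simp [ldBracket]
  rw [hb, map_add, map_smul, map_smul] at h
  simp only [LinearMap.add_apply, LinearMap.smul_apply, LinearMap.sub_apply,
    Module.End.mul_apply] at h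
  simp only [d, c]
  rw [add_assoc, h]
  abel

lemma actInvariant_of_d_c {M : Submodule ℂ W} (hd : ∀ n a, ∀ w ∈ M, D.d n a w ∈ M)
    (hc : ∀ a, ∀ w ∈ M, D.c a w ∈ M) : ActInvariant (fun x => D.ρ x) M := by
  rintro ⟨f, a⟩ w hw
  have hx : ((f, a) : LVir B) = (f, 0) + (0, a) := by simp
  simp only [hx, map_add, LinearMap.add_apply]
  refine M.add_mem ?_ (hc a w hw)
  induction f using Finsupp.induction_linear with
  | zero => rw [show ((0, 0) : LVir B) = 0 from rfl]; simp
  | add f g hf hg =>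
    rw [show ((f + g, 0) : LVir B) = (f, 0) + (g, 0) by simp, map_add]
    exact M.add_mem (hf (by simp)) (hg (by simp))
  | single n a' => exact hd n a' w hw

/-- Every vector of a highest weight module is killed by all `d_n ⊗ a` with `n` large. -/
lemma exists_forall_d_eq_zero (w : W) : ∃ N : ℤ, ∀ n, N ≤ n → ∀ a, D.d n a w = 0 := by
  let M : Submodule ℂ W :=
    { carrier := {w | ∃ N : ℤ, ∀ n, N ≤ n → ∀ a, D.d n a w = 0}
      zero_mem' := ⟨0, by simp⟩
      add_mem' := by
        rintro x y ⟨N, hN⟩ ⟨N', hN'⟩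
        refine ⟨max N N', fun n hn a => ?_⟩
        rw [map_add, hN n (by omega), hN' n (by omega), add_zero]
      smul_mem' := by
        rintro r x ⟨N, hN⟩
        exact ⟨N, fun n hn a => by rw [map_smul, hN n hn, smul_zero]⟩ }
  have hM : M = ⊤ := by
    refine D.gen M (D.actInvariant_of_d_c ?_ ?_) ?_
    · rintro m a' w ⟨N, hN⟩
      refine ⟨max (max N (N - m)) (1 - m), fun n hn a => ?_⟩
      rw [d_comm, hN n (by omega), hN (n + m) (by omega), if_neg (by omega)]
      simp
    · rintro a' w ⟨N, hN⟩
      refine ⟨N, fun n hn a => ?_⟩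
      have := hN n hn a
      simp only [d] at this ⊢
      rw [← c_comm, this, map_zero]
    · rintro _ rfl
      exact ⟨1, fun n hn a => D.hw n (by omega) a⟩
  exact (hM.symm ▸ Submodule.mem_top : w ∈ M)

/-- The sum of the weight spaces strictly below the highest weight. -/
def lowerWeights : Submodule ℂ W :=
  ⨆ k : ℕ, Module.End.eigenspace (D.d 0 1) (D.φd 1 - (k + 1))

lemma hv_notMem_lowerWeights : D.hv ∉ D.lowerWeights := by
  intro h
  have hind := (Module.End.eigenspaces_iSupIndep (D.d 0 1)) (D.φd 1)
  refine D.hv_ne (Submodule.disjoint_def.mp hind D.hv ?_ ?_)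
  · exact Module.End.mem_eigenspace_iff.mpr (D.wt0 1)
  · refine (iSup_le fun k => ?_ : D.lowerWeights ≤ _) h
    refine le_iSup₂_of_le (D.φd 1 - (k + 1)) (fun he => ?_) le_rfl
    have h0 : ((k + 1 : ℕ) : ℂ) = 0 := by push_cast; linear_combination -he
    exact Nat.succ_ne_zero k (Nat.cast_eq_zero.mp h0)

lemma d_mem_eigenspace {w : W} {μ : ℂ} (n : ℤ) (a : B)
    (hw : w ∈ Module.End.eigenspace (D.d 0 1) μ) :
    D.d n a w ∈ Module.End.eigenspace (D.d 0 1) (μ + n) := by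
  rw [Module.End.mem_eigenspace_iff] at hw ⊢
  rw [d_comm, hw]
  simp [add_smul]

lemma c_mem_eigenspace {w : W} {μ : ℂ} (a : B)
    (hw : w ∈ Module.End.eigenspace (D.d 0 1) μ) :
    D.c a w ∈ Module.End.eigenspace (D.d 0 1) μ := by
  rw [Module.End.mem_eigenspace_iff] at hw ⊢
  have h := D.c_comm a (Finsupp.single 0 1, 0) w
  rw [show D.ρ (Finsupp.single 0 1, 0) = D.d 0 1 from rfl, hw, map_smul] at h
  exact h.symm

lemma d_mem_lowerWeights {w : W} {n : ℤ} (hn : n ≤ 0) (a : B) (hw : w ∈ D.lowerWeights) :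
    D.d n a w ∈ D.lowerWeights := by
  suffices D.lowerWeights ≤ D.lowerWeights.comap (D.d n a) from this hw
  refine iSup_le fun k x hx => ?_
  obtain ⟨j, rfl⟩ := Int.exists_eq_neg_ofNat hn
  refine Submodule.mem_iSup_of_mem (k + j) ?_
  convert D.d_mem_eigenspace (-(j : ℤ)) a hx using 2
  push_cast
  ring

lemma c_mem_lowerWeights {w : W} (a : B) (hw : w ∈ D.lowerWeights) :
    D.c a w ∈ D.lowerWeights := by
  suffices D.lowerWeights ≤ D.lowerWeights.comap (D.c a) from this hw
  exact iSup_le fun k x hx => Submodule.mem_iSup_of_mem k (D.c_mem_eigenspace a hx)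

/-- The submodule generated by `u` under the operators of nonpositive degree. -/
def lowerSpan (u : W) : Submodule ℂ W :=
  sInf {M | u ∈ M ∧ (∀ n ≤ 0, ∀ a, ∀ w ∈ M, D.d n a w ∈ M) ∧ ∀ a, ∀ w ∈ M, D.c a w ∈ M}

lemma mem_lowerSpan (u : W) : u ∈ D.lowerSpan u :=
  Submodule.mem_sInf.mpr fun _ hM => hM.1

lemma d_mem_lowerSpan {u w : W} {n : ℤ} (hn : n ≤ 0) (a : B) (hw : w ∈ D.lowerSpan u) :
    D.d n a w ∈ D.lowerSpan u :=
  Submodule.mem_sInf.mpr fun M hM => hM.2.1 n hn a w (Submodule.mem_sInf.mp hw M hM)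

lemma c_mem_lowerSpan {u w : W} (a : B) (hw : w ∈ D.lowerSpan u) :
    D.c a w ∈ D.lowerSpan u :=
  Submodule.mem_sInf.mpr fun M hM => hM.2.2 a w (Submodule.mem_sInf.mp hw M hM)

lemma actInvariant_lowerSpan {u : W} (hu : ∀ n : ℤ, 0 < n → ∀ a, D.d n a u = 0) :
    ActInvariant (fun x => D.ρ x) (D.lowerSpan u) := by
  let N : Submodule ℂ W :=
    { carrier := {w | w ∈ D.lowerSpan u ∧ ∀ n : ℤ, 0 < n → ∀ a, D.d n a w ∈ D.lowerSpan u}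
      zero_mem' := ⟨zero_mem _, fun n _ a => by simp⟩
      add_mem' := fun hx hy => ⟨add_mem hx.1 hy.1, fun n hn a => by
        rw [map_add]; exact add_mem (hx.2 n hn a) (hy.2 n hn a)⟩
      smul_mem' := fun r x hx => ⟨Submodule.smul_mem _ r hx.1, fun n hn a => by
        rw [map_smul]; exact Submodule.smul_mem _ r (hx.2 n hn a)⟩ }
  have hN : D.lowerSpan u ≤ N := by
    refine sInf_le ⟨⟨D.mem_lowerSpan u, fun n hn a => by simp [hu n hn a]⟩, ?_, ?_⟩
    · rintro m hm a' w ⟨hw, hw'⟩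
      refine ⟨D.d_mem_lowerSpan hm a' hw, fun n hn a => ?_⟩
      rw [d_comm]
      refine add_mem (add_mem (D.d_mem_lowerSpan hm a' (hw' n hn a)) (Submodule.smul_mem _ _ ?_))
        (Submodule.smul_mem _ _ (D.c_mem_lowerSpan _ hw))
      rcases le_or_gt (n + m) 0 with h | h
      · exact D.d_mem_lowerSpan h _ hw
      · exact hw' _ h _
    · rintro a' w ⟨hw, hw'⟩
      refine ⟨D.c_mem_lowerSpan a' hw, fun n hn a => ?_⟩
      have h := D.c_mem_lowerSpan a' (hw' n hn a)
      simp only [d] at h ⊢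
      rwa [c_comm] at h
  refine D.actInvariant_of_d_c (fun n a w hw => ?_) fun a w hw => D.c_mem_lowerSpan a hw
  rcases le_or_gt n 0 with h | h
  · exact D.d_mem_lowerSpan h a hw
  · exact (hN hw).2 n h a

/-- A singular vector below the highest weight of an irreducible highest weight module is zero. -/
lemma eq_zero_of_singular {u : W} (hu : ∀ n : ℤ, 0 < n → ∀ a, D.d n a u = 0)
    (hlow : u ∈ D.lowerWeights) : u = 0 := by
  rcases D.irr _ (D.actInvariant_lowerSpan hu) with h | h
  · simpa [h] using D.mem_lowerSpan u
  · have hle : D.lowerSpan u ≤ D.lowerWeights :=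
      sInf_le ⟨hlow, fun n hn a w hw => D.d_mem_lowerWeights hn a hw,
        fun a w hw => D.c_mem_lowerWeights a hw⟩
    exact absurd (hle (h ▸ Submodule.mem_top)) D.hv_notMem_lowerWeights

lemma d_neg_one_hv {b : B} (hφ : ∀ a ∈ Ideal.span {b}, D.φd a = 0) :
    D.d (-1) b D.hv = 0 := by
  refine D.eq_zero_of_singular (fun n hn a => ?_) (Submodule.mem_iSup_of_mem 0 ?_)
  · rw [d_comm, show D.d n a D.hv = 0 from D.hw n hn a, map_zero, zero_add]
    rcases eq_or_ne n 1 with rfl | h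
    · have h0 : D.d (1 + -1) (a * b) D.hv = 0 := by
        refine (D.wt0 (a * b)).trans ?_
        rw [hφ _ (Ideal.mul_mem_left _ a (Ideal.mem_span_singleton_self b)), zero_smul]
      rw [h0]
      simp
    · rw [show D.d (n + -1) (a * b) D.hv = 0 from D.hw _ (by omega) _, if_neg (by omega)]
      simp
  · have h1 : D.hv ∈ Module.End.eigenspace (D.d 0 1) (D.φd 1) :=
      Module.End.mem_eigenspace_iff.mpr (D.wt0 1)
    convert D.d_mem_eigenspace (-1) b h1 using 2
    push_cast
    ring

end HWRep

end HighestWeight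

section Tensor

variable {B} {W : Type*} [AddCommGroup W] [Module ℂ W] (D : HWRep B W) (α β : ℂ) (ψ : B →ₐ[ℂ] ℂ)

lemma tensAct_d_tmul (n k : ℤ) (a : B) (w : W) :
    tensAct B D α β ψ (Finsupp.single n a, 0) (w ⊗ₜ Finsupp.single k 1) =
      D.d n a w ⊗ₜ Finsupp.single k 1 +
        (ψ a * (α + k + n * β)) • (w ⊗ₜ[ℂ] Finsupp.single (k + n) (1 : ℂ)) := by
  have h : lAction B α β ψ (Finsupp.single n a, 0) (Finsupp.single k 1) =
      (ψ a * (α + k + n * β)) • Finsupp.single (k + n) (1 : ℂ) := by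
    simp [lAction, dAct, -Finsupp.single_mul, -Finsupp.single_add]
  rw [tensAct, LinearMap.add_apply, TensorProduct.map_tmul, TensorProduct.map_tmul, h,
    TensorProduct.tmul_smul]
  rfl

lemma tensAct_c_tmul (a : B) (w : W) (v : ℤ →₀ ℂ) :
    tensAct B D α β ψ (0, a) (w ⊗ₜ v) = D.c a w ⊗ₜ v := by
  simp [tensAct, HWRep.c, lAction]

variable (W) in
/-- The map `∑ w_k ↦ ∑ w_k ⊗ v_{k+s}`. -/
def shiftTensor (s : ℤ) : (ℤ →₀ W) →ₗ[ℂ] W ⊗[ℂ] (ℤ →₀ ℂ) :=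
  Finsupp.lsum ℂ fun k => (TensorProduct.mk ℂ W (ℤ →₀ ℂ)).flip (Finsupp.single (k + s) 1)

variable (W) in
/-- The diagonal operator scaling the `k`-th coordinate by `α + k`. -/
def weightScale : (ℤ →₀ W) →ₗ[ℂ] (ℤ →₀ W) :=
  Finsupp.lsum ℂ fun k => (α + (k : ℂ)) • Finsupp.lsingle k

@[simp]
lemma shiftTensor_single (s k : ℤ) (x : W) :
    shiftTensor W s (Finsupp.single k x) = x ⊗ₜ Finsupp.single (k + s) 1 := by
  simp [shiftTensor]

@[simp]
lemma weightScale_single (k : ℤ) (x : W) :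
    weightScale W α (Finsupp.single k x) = (α + (k : ℂ)) • Finsupp.single k x := by
  simp [weightScale]

lemma weightScale_apply (w : ℤ →₀ W) (k : ℤ) : weightScale W α w k = (α + (k : ℂ)) • w k := by
  induction w using Finsupp.induction_linear with
  | zero => simp
  | add f g hf hg => simp [hf, hg]
  | single j x =>
    rw [weightScale_single, Finsupp.smul_apply]
    rcases eq_or_ne j k with rfl | h
    · rfl
    · simp [Finsupp.single_eq_of_ne' h]

lemma shiftTensor_zero_surjective : Function.Surjective (shiftTensor W 0) := by
  rw [← LinearMap.range_eq_top, eq_top_iff]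
  rintro t -
  induction t using TensorProduct.induction_on with
  | zero => exact zero_mem _
  | add x y hx hy => exact add_mem hx hy
  | tmul x v =>
    induction v using Finsupp.induction_linear with
    | zero => simp
    | add f g hf hg => rw [TensorProduct.tmul_add]; exact add_mem hf hg
    | single k r =>
      refine ⟨Finsupp.single k (r • x), ?_⟩
      rw [shiftTensor_single, TensorProduct.smul_tmul, Finsupp.smul_single]
      simp

/-- For `n` large, `d_n ⊗ 1` acts on a given tensor through the second factor only. -/
lemma exists_forall_tensAct_shiftTensor (w : ℤ →₀ W) : ∃ N : ℤ, ∀ n, N ≤ n → ∀ s,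
    tensAct B D α β ψ (Finsupp.single n 1, 0) (shiftTensor W s w) =
      shiftTensor W (s + n) (weightScale W α w) +
        ((s : ℂ) + n * β) • shiftTensor W (s + n) w := by
  induction w using Finsupp.induction_linear with
  | zero => exact ⟨0, by simp⟩
  | add f g hf hg =>
    obtain ⟨N, hN⟩ := hf
    obtain ⟨N', hN'⟩ := hg
    refine ⟨max N N', fun n hn s => ?_⟩
    simp only [map_add, smul_add]
    rw [hN n (by omega), hN' n (by omega)]
    abel
  | single k x =>
    obtain ⟨N, hN⟩ := D.exists_forall_d_eq_zero x
    refine ⟨N, fun n hn s => ?_⟩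
    rw [shiftTensor_single, tensAct_d_tmul, hN n hn, TensorProduct.zero_tmul, zero_add,
      weightScale_single, map_smul, shiftTensor_single, ← add_smul, map_one, add_assoc k s n]
    congr 1
    push_cast
    ring

/-- The families `w` whose shifted tensors eventually lie in `U`. -/
def eventualShift (U : Submodule ℂ (W ⊗[ℂ] (ℤ →₀ ℂ))) : Submodule ℂ (ℤ →₀ W) where
  carrier := {w | ∃ J : ℤ, ∀ s, J ≤ s → shiftTensor W s w ∈ U}
  zero_mem' := ⟨0, by simp⟩
  add_mem' := by
    rintro x y ⟨J, hJ⟩ ⟨J', hJ'⟩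
    refine ⟨max J J', fun s hs => ?_⟩
    rw [map_add]
    exact add_mem (hJ s (by omega)) (hJ' s (by omega))
  smul_mem' := by
    rintro r x ⟨J, hJ⟩
    exact ⟨J, fun s hs => by rw [map_smul]; exact U.smul_mem r (hJ s hs)⟩

variable {α β} {D} {ψ} {U : Submodule ℂ (W ⊗[ℂ] (ℤ →₀ ℂ))}

lemma weightScale_mem_eventualShift (hU : ActInvariant (tensAct B D α β ψ) U) {w : ℤ →₀ W}
    (hw : w ∈ eventualShift U) : weightScale W α w ∈ eventualShift U := by
  obtain ⟨J, hJ⟩ := hw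
  obtain ⟨N, hN⟩ := exists_forall_tensAct_shiftTensor D α β ψ w
  refine ⟨max J (J + N), fun s hs => ?_⟩
  have h := hU (Finsupp.single N 1, 0) _ (hJ (s - N) (by omega))
  rw [hN N le_rfl, sub_add_cancel] at h
  exact (U.add_mem_iff_left (U.smul_mem _ (hJ s (by omega)))).mp h

lemma mem_eventualShift_of_ne (hU : ActInvariant (tensAct B D α β ψ) U) (hβ0 : β ≠ 0)
    (hβ1 : β ≠ 1) {w : ℤ →₀ W} (hw : shiftTensor W 0 w ∈ U) : w ∈ eventualShift U := by
  obtain ⟨N₁, hN₁⟩ := exists_forall_tensAct_shiftTensor D α β ψ w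
  obtain ⟨N₂, hN₂⟩ := exists_forall_tensAct_shiftTensor D α β ψ (weightScale W α w)
  have key : ∀ s m : ℤ, max N₁ N₂ ≤ m → max N₁ N₂ ≤ s - m →
      shiftTensor W s (weightScale W α (weightScale W α w)) +
        ((s : ℂ) * β + m) • shiftTensor W s (weightScale W α w) +
        ((m : ℂ) * β * (s * β + m * (1 - β))) • shiftTensor W s w ∈ U := by
    intro s m hm hs
    have h := hU (Finsupp.single (s - m) 1, 0) _ (hU (Finsupp.single m 1, 0) _ hw)
    rw [hN₁ m (by omega), map_add, map_smul, hN₂ (s - m) (by omega), hN₁ (s - m) (by omega),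
      zero_add, add_sub_cancel] at h
    convert h using 1
    push_cast
    module
  refine ⟨2 * max N₁ N₂ + 2, fun s hs => ?_⟩
  set m := max N₁ N₂
  have h0 := key s m (by omega) (by omega)
  have h1 := key s (m + 1) (by omega) (by omega)
  have h2 := key s (m + 2) (by omega) (by omega)
  have h := U.add_mem (U.sub_mem h2 (U.smul_mem (2 : ℂ) h1)) h0
  have hne : 2 * β * (1 - β) ≠ 0 :=
    mul_ne_zero (mul_ne_zero two_ne_zero hβ0) (sub_ne_zero.mpr hβ1.symm)
  refine (U.smul_mem_iff hne).mp ?_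
  convert h using 1
  push_cast
  module

lemma weightScale_mem_eventualShift_of_eq_zero (hU : ActInvariant (tensAct B D α 0 ψ) U)
    {w : ℤ →₀ W} (hw : shiftTensor W 0 w ∈ U) : weightScale W α w ∈ eventualShift U := by
  obtain ⟨N, hN⟩ := exists_forall_tensAct_shiftTensor D α 0 ψ w
  refine ⟨N, fun s hs => ?_⟩
  have h := hU (Finsupp.single s 1, 0) _ hw
  rw [hN s hs] at h
  simpa using h

/-- A nonzero subspace of `ℤ →₀ W` stable under the diagonal operator contains a nonzero vector
supported at one point. -/
lemma exists_single_mem {S : Submodule ℂ (ℤ →₀ W)} (hS : ∀ w ∈ S, weightScale W α w ∈ S)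
    {w : ℤ →₀ W} (hw : w ∈ S) (hw0 : w ≠ 0) : ∃ k x, x ≠ 0 ∧ Finsupp.single k x ∈ S := by
  induction hn : w.support.card using Nat.strong_induction_on generalizing w with
  | _ n ih =>
    obtain ⟨k, hk⟩ := Finsupp.support_nonempty_iff.mpr hw0
    set w' := weightScale W α w - (α + (k : ℂ)) • w with hw'
    have hval : ∀ j, w' j = ((j : ℂ) - k) • w j := by
      intro j
      rw [hw', Finsupp.sub_apply, Finsupp.smul_apply, weightScale_apply, ← sub_smul]
      congr 1
      ring
    by_cases h0 : w' = 0
    · refine ⟨k, w k, Finsupp.mem_support_iff.mp hk, ?_⟩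
      convert hw
      ext j
      rcases eq_or_ne j k with rfl | hj
      · simp
      · have h := hval j
        rw [h0, Finsupp.zero_apply, eq_comm, smul_eq_zero, sub_eq_zero, Int.cast_inj] at h
        rw [Finsupp.single_eq_of_ne hj, h.resolve_left hj]
    · refine ih _ ?_ (S.sub_mem (hS w hw) (S.smul_mem _ hw)) h0 rfl
      rw [← hn]
      refine Finset.card_lt_card ((Finset.ssubset_iff_of_subset fun j hj => ?_).mpr ⟨k, hk, ?_⟩)
      · rw [Finsupp.mem_support_iff, hval] at hj
        exact Finsupp.mem_support_iff.mpr (right_ne_zero_of_smul hj)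
      · rw [Finsupp.notMem_support_iff, hval, sub_self, zero_smul]

/-- If one nonzero `x` has `x ⊗ v_j ∈ U` for all large `j`, then so does every vector. -/
lemma exists_forall_tmul_mem (hU : ActInvariant (tensAct B D α β ψ) U) {x : W} (hx : x ≠ 0)
    {J : ℤ} (hJ : ∀ j, J ≤ j → x ⊗ₜ[ℂ] Finsupp.single j (1 : ℂ) ∈ U) (y : W) :
    ∃ J : ℤ, ∀ j, J ≤ j → y ⊗ₜ[ℂ] Finsupp.single j (1 : ℂ) ∈ U := by
  let Q : Submodule ℂ W :=
    { carrier := {x | ∃ J : ℤ, ∀ j, J ≤ j → x ⊗ₜ[ℂ] Finsupp.single j (1 : ℂ) ∈ U}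
      zero_mem' := ⟨0, by simp⟩
      add_mem' := by
        rintro x y ⟨J, hJ⟩ ⟨J', hJ'⟩
        refine ⟨max J J', fun j hj => ?_⟩
        rw [TensorProduct.add_tmul]
        exact add_mem (hJ j (by omega)) (hJ' j (by omega))
      smul_mem' := by
        rintro r x ⟨J, hJ⟩
        exact ⟨J, fun j hj => by
          rw [← TensorProduct.smul_tmul']; exact U.smul_mem r (hJ j hj)⟩ }
  have hQ : ActInvariant (fun x => D.ρ x) Q := by
    refine D.actInvariant_of_d_c ?_ ?_
    · rintro n a w ⟨J, hJ⟩
      refine ⟨max J (J - n), fun j hj => ?_⟩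
      have h := hU (Finsupp.single n a, 0) _ (hJ j (by omega))
      rw [tensAct_d_tmul] at h
      exact (U.add_mem_iff_left (U.smul_mem _ (hJ (j + n) (by omega)))).mp h
    · rintro a w ⟨J, hJ⟩
      refine ⟨J, fun j hj => ?_⟩
      have h := hU (0, a) _ (hJ j hj)
      rwa [tensAct_c_tmul] at h
  rcases D.irr Q hQ with h | h
  · exact absurd ((Submodule.mem_bot ℂ).mp (h ▸ (⟨J, hJ⟩ : x ∈ Q))) hx
  · exact (h.symm ▸ Submodule.mem_top : y ∈ Q)

/-- The tensor module is generated by `v_φ ⊗ V'`. -/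
lemma eq_top_of_hv_tmul_mem (hU : ActInvariant (tensAct B D α β ψ) U)
    (h : ∀ v, D.hv ⊗ₜ[ℂ] v ∈ U) : U = ⊤ := by
  let P : Submodule ℂ W :=
    { carrier := {w | ∀ v : ℤ →₀ ℂ, w ⊗ₜ[ℂ] v ∈ U}
      zero_mem' := fun v => by simp
      add_mem' := fun hx hy v => by
        rw [TensorProduct.add_tmul]; exact add_mem (hx v) (hy v)
      smul_mem' := fun r x hx v => by
        rw [← TensorProduct.smul_tmul']; exact U.smul_mem r (hx v) }
  have hP : P = ⊤ := by
    refine D.gen P (fun x w hw v => ?_) (by rintro _ rfl; exact h)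
    have h' := hU x _ (hw v)
    simp only [tensAct, LinearMap.add_apply, TensorProduct.map_tmul, LinearMap.id_apply] at h'
    exact (U.add_mem_iff_left (hw _)).mp h'
  rw [eq_top_iff]
  rintro t -
  induction t using TensorProduct.induction_on with
  | zero => exact zero_mem _
  | add x y hx hy => exact add_mem hx hy
  | tmul x v => exact (hP.symm ▸ Submodule.mem_top : x ∈ P) v

lemma hv_tmul_mem (hU : ActInvariant (tensAct B D α β ψ) U)
    (hαβ : ∀ z : ℤ, α + β ≠ (z : ℂ)) (hαβ' : ∀ z : ℤ, α - β ≠ (z : ℂ))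
    {b : B} (hψb : ψ b ≠ 0) (hb : D.d (-1) b D.hv = 0) {j : ℤ}
    (hj : D.hv ⊗ₜ[ℂ] Finsupp.single j (1 : ℂ) ∈ U) (v : ℤ →₀ ℂ) : D.hv ⊗ₜ[ℂ] v ∈ U := by
  have hstep : ∀ k : ℤ, D.hv ⊗ₜ[ℂ] Finsupp.single k (1 : ℂ) ∈ U := by
    intro k
    induction k using Int.inductionOn' (b := j) with
    | zero => exact hj
    | succ k _ ih =>
      have h := hU (Finsupp.single 1 b, 0) _ ih
      rw [tensAct_d_tmul, show D.d 1 b D.hv = 0 from D.hw 1 one_pos b, TensorProduct.zero_tmul,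
        zero_add] at h
      refine (U.smul_mem_iff (mul_ne_zero hψb fun h0 => hαβ (-k) ?_)).mp h
      push_cast at h0 ⊢
      linear_combination h0
    | pred k _ ih =>
      have h := hU (Finsupp.single (-1) b, 0) _ ih
      rw [tensAct_d_tmul, hb, TensorProduct.zero_tmul, zero_add] at h
      refine (U.smul_mem_iff (mul_ne_zero hψb fun h0 => hαβ' (-k) ?_)).mp h
      push_cast at h0 ⊢
      linear_combination h0
  induction v using Finsupp.induction_linear with
  | zero => simp
  | add f g hf hg => rw [TensorProduct.tmul_add]; exact add_mem hf hg
  | single k r =>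
    rw [← mul_one r, ← smul_eq_mul, ← Finsupp.smul_single, TensorProduct.tmul_smul]
    exact U.smul_mem r (hstep k)

end Tensor

/-- Suppose `α ± β ∉ ℤ` and `b ∈ B` with `ψ(b) ≠ 0`.  If `φ` vanishes on `d_0 ⊗ ⟨b⟩`,
where `⟨b⟩` is the ideal of `B` generated by `b`, then the `Vir_B`-module
`V^φ_{α,β,ψ} = V(φ) ⊗ V'_{α,β,ψ}` is irreducible. -/
theorem tensor_irreducible_of_phi_vanishes {W : Type*} [AddCommGroup W] [Module ℂ W]
    (D : HWRep B W) (α β : ℂ) (hα0 : 0 ≤ α.re) (hα1 : α.re < 1) (hβ : β ≠ 1)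
    (hαβ : ∀ z : ℤ, α + β ≠ (z : ℂ)) (hαβ' : ∀ z : ℤ, α - β ≠ (z : ℂ))
    (ψ : B →ₐ[ℂ] ℂ) (hirr : ActIrreducible (fun x : LVir B => lAction B α β ψ x))
    (b : B) (hψb : ψ b ≠ 0)
    (hφ : ∀ a ∈ Ideal.span {b}, D.φd a = 0) :
    ActIrreducible (V := W ⊗[ℂ] (ℤ →₀ ℂ)) (tensAct B D α β ψ) := by
  intro U hU
  refine or_iff_not_imp_left.mpr fun hbot => ?_
  obtain ⟨t, ht, ht0⟩ := Submodule.exists_mem_ne_zero_of_ne_bot hbot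
  obtain ⟨w, rfl⟩ := shiftTensor_zero_surjective t
  have hw0 : w ≠ 0 := by
    rintro rfl
    exact ht0 (map_zero _)
  obtain ⟨w', hw', hw'0⟩ : ∃ w' ∈ eventualShift U, w' ≠ 0 := by
    rcases eq_or_ne β 0 with rfl | hβ0
    · refine ⟨_, weightScale_mem_eventualShift_of_eq_zero hU ht, fun h => hw0 ?_⟩
      ext k
      have hk := weightScale_apply α w k
      rw [h, Finsupp.zero_apply, eq_comm, smul_eq_zero] at hk
      refine hk.resolve_left fun h0 => hαβ (-k) ?_
      push_cast
      linear_combination h0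
    · exact ⟨w, mem_eventualShift_of_ne hU hβ0 hβ ht, hw0⟩
  obtain ⟨k, x, hx0, J, hJ⟩ :=
    exists_single_mem (α := α) (fun _ h => weightScale_mem_eventualShift hU h) hw' hw'0
  have hx : ∀ j, k + J ≤ j → x ⊗ₜ[ℂ] Finsupp.single j (1 : ℂ) ∈ U := fun j hj => by
    have h := hJ (j - k) (by omega)
    rwa [shiftTensor_single, add_sub_cancel] at h
  obtain ⟨J', hJ'⟩ := exists_forall_tmul_mem hU hx0 hx D.hv
  exact eq_top_of_hv_tmul_mem hU
    (hv_tmul_mem hU hαβ hαβ' hψb (D.d_neg_one_hv hφ) (hJ' J' le_rfl))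
end
end
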